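/- Let Λ be an n-dimensional lattice in ℝ^n, let c > 1/√(2π), and set C = c·√(2πe)·e^{-πc²} (so C < 1). If τ > √n·c / λ₁(Λ), where λ₁(Λ) is the minimum norm of a nonzero lattice vector, then ∑_{λ ∈ Λ \ {0}} e^{-τ²π‖λ‖²} ≤ Cⁿ/(1-Cⁿ). -/

import Mathlib

open scoped Real

/-- The minimum distance `λ₁(Λ)` of a lattice: the smallest norm of a nonzero vector. -/
noncomputable def latticeMinDist {n : ℕ} (L : Submodule ℤ (EuclideanSpace ℝ (Fin n))) : ℝ :=
  sInf {r : ℝ | ∃ x ∈ L, x ≠ 0 ∧ r = ‖x‖}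

noncomputable def latGauss {n : ℕ} (L : Submodule ℤ (EuclideanSpace ℝ (Fin n))) (b : ℝ)
    (y : EuclideanSpace ℝ (Fin n)) : ℝ :=
  ∑' x : L, Real.exp (-(b * ‖(x : EuclideanSpace ℝ (Fin n)) + y‖ ^ 2))

theorem gauss_summable_zero {n : ℕ} (L : Submodule ℤ (EuclideanSpace ℝ (Fin n)))
    [DiscreteTopology L] {b : ℝ} (hb : 0 < b) :
    Summable fun x : L => Real.exp (-(b * ‖(x : EuclideanSpace ℝ (Fin n))‖ ^ 2)) := by
  set N := Module.finrank ℤ L + 1 with hN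
  have h := (ZLattice.summable_norm_pow_inv L (2 * N) (by omega)).mul_left
    ((N.factorial : ℝ) / b ^ N)
  refine Summable.of_norm_bounded_eventually h ?_
  refine (Set.finite_singleton (0 : L)).subset ?_
  intro x hx
  by_contra hne
  apply hx
  have hx0 : x ≠ 0 := hne
  have hpos : 0 < ‖x‖ := norm_pos_iff.mpr hx0
  have h1 := Real.pow_div_factorial_le_exp (b * ‖x‖ ^ 2) (by positivity) N
  have hcoe : ‖(x : EuclideanSpace ℝ (Fin n))‖ = ‖x‖ := rfl
  rw [Set.mem_ofPred_eq, Real.norm_of_nonneg (Real.exp_pos _).le, hcoe, Real.exp_neg]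
  have h2 : (N.factorial : ℝ) / b ^ N * ‖x‖⁻¹ ^ (2 * N)
      = ((b * ‖x‖ ^ 2) ^ N / N.factorial)⁻¹ := by
    rw [mul_pow, ← pow_mul, inv_pow]
    field_simp
  rw [h2]
  exact inv_anti₀ (by positivity) h1

theorem gauss_term_le {n : ℕ} {b : ℝ} (hb : 0 < b) (x y : EuclideanSpace ℝ (Fin n)) :
    Real.exp (-(b * ‖x + y‖ ^ 2)) ≤ Real.exp (b * ‖y‖ ^ 2) * Real.exp (-(b / 2 * ‖x‖ ^ 2)) := by
  rw [← Real.exp_add]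
  apply Real.exp_le_exp.mpr
  have h := norm_sub_le (x + y) y
  rw [add_sub_cancel_right] at h
  have h3 : ‖x‖ ^ 2 ≤ 2 * ‖x + y‖ ^ 2 + 2 * ‖y‖ ^ 2 := by
    nlinarith [sq_nonneg (‖x + y‖ - ‖y‖), norm_nonneg x, norm_nonneg y, norm_nonneg (x + y)]
  nlinarith

theorem gauss_summable {n : ℕ} (L : Submodule ℤ (EuclideanSpace ℝ (Fin n)))
    [DiscreteTopology L] {b : ℝ} (hb : 0 < b) (y : EuclideanSpace ℝ (Fin n)) :
    Summable fun x : L => Real.exp (-(b * ‖(x : EuclideanSpace ℝ (Fin n)) + y‖ ^ 2)) :=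
  Summable.of_nonneg_of_le (fun _ => (Real.exp_pos _).le) (fun _ => gauss_term_le hb _ _)
    ((gauss_summable_zero L (half_pos hb)).mul_left _)

theorem lattice_cover {n : ℕ} (L : Submodule ℤ (EuclideanSpace ℝ (Fin n))) [DiscreteTopology L]
    (hspan : Submodule.span ℝ (L : Set (EuclideanSpace ℝ (Fin n))) = ⊤) :
    ∃ R : ℝ, ∀ y, ∃ x : L, ‖(x : EuclideanSpace ℝ (Fin n)) + y‖ ≤ R := by
  have : IsZLattice ℝ L := ⟨hspan⟩
  have := ZLattice.module_finite ℝ L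
  have := ZLattice.module_free ℝ L
  let b0 := Module.Free.chooseBasis ℤ L
  let b := b0.ofZLatticeBasis ℝ L
  refine ⟨∑ i, ‖b i‖, fun y => ?_⟩
  have hm : (ZSpan.floor b y : EuclideanSpace ℝ (Fin n)) ∈ L := by
    exact (b0.ofZLatticeBasis_span ℝ).le (ZSpan.floor b y).2
  refine ⟨-⟨_, hm⟩, ?_⟩
  have := ZSpan.norm_fract_le b y
  rw [ZSpan.fract_apply] at this
  simpa [neg_add_eq_sub] using this

theorem latGauss_nonneg {n : ℕ} (L : Submodule ℤ (EuclideanSpace ℝ (Fin n))) (b : ℝ)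
    (y : EuclideanSpace ℝ (Fin n)) : 0 ≤ latGauss L b y :=
  tsum_nonneg fun _ => (Real.exp_pos _).le

theorem latGauss_bdd {n : ℕ} (L : Submodule ℤ (EuclideanSpace ℝ (Fin n))) [DiscreteTopology L]
    (hspan : Submodule.span ℝ (L : Set (EuclideanSpace ℝ (Fin n))) = ⊤) {b : ℝ} (hb : 0 < b) :
    BddAbove (Set.range (latGauss L b)) := by
  obtain ⟨R, hR⟩ := lattice_cover L hspan
  refine ⟨Real.exp (b * R ^ 2) *
    ∑' x : L, Real.exp (-(b / 2 * ‖(x : EuclideanSpace ℝ (Fin n))‖ ^ 2)), ?_⟩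
  rintro _ ⟨y, rfl⟩
  obtain ⟨x0, hx0⟩ := hR y
  have h1 : latGauss L b y = latGauss L b (x0 + y) := by
    unfold latGauss
    rw [← (Equiv.addRight x0).tsum_eq]
    simp [add_assoc]
  rw [h1, ← tsum_mul_left]
  refine Summable.tsum_le_tsum (fun x => ?_) (gauss_summable L hb _)
    ((gauss_summable_zero L (half_pos hb)).mul_left _)
  refine (gauss_term_le hb _ _).trans ?_
  gcongr

theorem lattice_pair_bij {n : ℕ} (L : Submodule ℤ (EuclideanSpace ℝ (Fin n))) :
    Function.Bijective (fun p : (L ⧸ (LinearMap.lsmul ℤ L 2).range) × (L × L) =>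
      ((p.2.1 + p.2.2 + p.1.out, p.2.1 - p.2.2) : L × L)) := by
  have key : ∀ (q : L ⧸ (LinearMap.lsmul ℤ L 2).range) (m : L),
      (Submodule.Quotient.mk ((2 : ℤ) • m + q.out) : L ⧸ (LinearMap.lsmul ℤ L 2).range) = q := by
    intro q m
    have h0 : (Submodule.Quotient.mk ((2 : ℤ) • m) : L ⧸ (LinearMap.lsmul ℤ L 2).range) = 0 :=
      (Submodule.Quotient.mk_eq_zero _).mpr ⟨m, rfl⟩
    rw [Submodule.Quotient.mk_add, h0, zero_add]
    exact Quotient.out_eq' q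
  constructor
  · rintro ⟨q, l, m⟩ ⟨q', l', m'⟩ h
    simp only [Prod.mk.injEq] at h
    obtain ⟨h1, h2⟩ := h
    have h3 : (2 : ℤ) • m + q.out = (2 : ℤ) • m' + q'.out := by
      have : (l + m + q.out) - (l - m) = (l' + m' + q'.out) - (l' - m') := by rw [h1, h2]
      calc _ = (l + m + q.out) - (l - m) := by module
        _ = _ := this
        _ = _ := by module
    have hq : q = q' := by rw [← key q m, h3, key]
    subst hq
    have h4 : (2 : ℤ) • m = (2 : ℤ) • m' := add_right_cancel h3
    have hm : m = m' := by
      apply Subtype.ext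
      have h5 := congrArg (fun z : L => (1 / 2 : ℝ) • (z : EuclideanSpace ℝ (Fin n))) h4
      simp only [Submodule.coe_smul] at h5
      calc (m : EuclideanSpace ℝ (Fin n)) = (1 / 2 : ℝ) • ((2 : ℤ) • (m : EuclideanSpace ℝ (Fin n))) := by module
        _ = _ := h5
        _ = _ := by module
    subst hm
    have hl : l = l' := sub_left_injective h2
    rw [hl]
  · rintro ⟨x, x'⟩
    set q : L ⧸ (LinearMap.lsmul ℤ L 2).range := Submodule.Quotient.mk (x - x') with hq
    have : (x - x') - q.out ∈ (LinearMap.lsmul ℤ L 2).range := by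
      rw [← Submodule.Quotient.eq]
      exact (Quotient.out_eq' q).symm
    obtain ⟨m, hm⟩ := this
    have hm' : (2 : ℤ) • m = (x - x') - q.out := hm
    refine ⟨(q, x' + m, m), ?_⟩
    simp only [Prod.mk.injEq]
    refine ⟨?_, by abel⟩
    calc x' + m + m + q.out = x' + (2 : ℤ) • m + q.out := by module
      _ = x := by rw [hm']; abel

theorem gauss_pair {n : ℕ} (b : ℝ) (u v p q : EuclideanSpace ℝ (Fin n))
    (hp : p + q = (2 : ℝ) • u) (hq : p - q = (2 : ℝ) • v) :
    Real.exp (-(b * ‖p‖ ^ 2)) * Real.exp (-(b * ‖q‖ ^ 2)) =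
      Real.exp (-(2 * b * ‖u‖ ^ 2)) * Real.exp (-(2 * b * ‖v‖ ^ 2)) := by
  rw [← Real.exp_add, ← Real.exp_add]
  congr 1
  have h := parallelogram_law_with_norm ℝ p q
  rw [hp, hq, norm_smul, norm_smul] at h
  simp only [Real.norm_ofNat] at h
  linear_combination (b / 2) * h

theorem latGauss_mul {n : ℕ} (L : Submodule ℤ (EuclideanSpace ℝ (Fin n))) [DiscreteTopology L]
    {b : ℝ} (hb : 0 < b) (u v : EuclideanSpace ℝ (Fin n)) :
    HasSum (fun q : L ⧸ (LinearMap.lsmul ℤ L 2).range =>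
      latGauss L (2 * b) ((1 / 2 : ℝ) • (q.out : EuclideanSpace ℝ (Fin n)) + u) *
      latGauss L (2 * b) ((1 / 2 : ℝ) • (q.out : EuclideanSpace ℝ (Fin n)) + v))
      (latGauss L b (u + v) * latGauss L b (u - v)) := by
  have hprod : ∀ (b : ℝ) (_ : 0 < b) (y z : EuclideanSpace ℝ (Fin n)),
      HasSum (fun p : L × L => Real.exp (-(b * ‖(p.1 : EuclideanSpace ℝ (Fin n)) + y‖ ^ 2)) *
        Real.exp (-(b * ‖(p.2 : EuclideanSpace ℝ (Fin n)) + z‖ ^ 2)))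
        (latGauss L b y * latGauss L b z) := by
    intro b hb y z
    have hy := gauss_summable L hb y
    have hz := gauss_summable L hb z
    exact hy.hasSum.mul hz.hasSum
      (hy.mul_of_nonneg hz (fun _ => (Real.exp_pos _).le) (fun _ => (Real.exp_pos _).le))
  have h1 := (Equiv.ofBijective _ (lattice_pair_bij L)).hasSum_iff.mpr (hprod b hb (u + v) (u - v))
  refine h1.prod_fiberwise (fun q => ?_)
  convert hprod (2 * b) (by positivity) ((1 / 2 : ℝ) • (q.out : EuclideanSpace ℝ (Fin n)) + u)
    ((1 / 2 : ℝ) • (q.out : EuclideanSpace ℝ (Fin n)) + v) using 2 with p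
  refine gauss_pair b _ _ _ _ ?_ ?_
  · simp only [Equiv.ofBijective_apply, Submodule.coe_add, Submodule.coe_sub]
    module
  · simp only [Equiv.ofBijective_apply, Submodule.coe_add, Submodule.coe_sub]
    module

theorem latGauss_le_zero {n : ℕ} (L : Submodule ℤ (EuclideanSpace ℝ (Fin n))) [DiscreteTopology L]
    (hspan : Submodule.span ℝ (L : Set (EuclideanSpace ℝ (Fin n))) = ⊤) {b : ℝ} (hb : 0 < b)
    (y : EuclideanSpace ℝ (Fin n)) : latGauss L b y ≤ latGauss L b 0 := by
  have hbdd := latGauss_bdd L hspan hb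
  set M := ⨆ y, latGauss L b y with hM
  have hle : ∀ y, latGauss L b y ≤ M := fun y => le_ciSup hbdd y
  set F0 := latGauss L b 0 with hF0
  have hF0n : 0 ≤ F0 := latGauss_nonneg L b 0
  have hMn : 0 ≤ M := hF0n.trans (hle 0)
  have key : ∀ y, latGauss L b y ^ 2 ≤ (M * F0 + F0 ^ 2) / 2 := by
    intro y
    have e1 := latGauss_mul L hb y 0
    have e2 := latGauss_mul L hb y y
    have e3 := latGauss_mul L hb 0 0
    have e4 := (e2.add e3).div_const 2
    have := hasSum_le (fun q => by
      nlinarith [sq_nonneg (latGauss L (2 * b)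
          ((1 / 2 : ℝ) • (Quotient.out q : L).1 + y) -
        latGauss L (2 * b) ((1 / 2 : ℝ) • (Quotient.out q : L).1 + 0))]) e1 e4
    simp only [add_zero, sub_zero, sub_self, ← hF0] at this
    nlinarith [mul_le_mul_of_nonneg_right (hle (y + y)) hF0n]
  have hsq : M ≤ Real.sqrt ((M * F0 + F0 ^ 2) / 2) :=
    ciSup_le fun y => Real.le_sqrt_of_sq_le (key y)
  have h2 : M ^ 2 ≤ (M * F0 + F0 ^ 2) / 2 := by
    rw [← Real.sq_sqrt (show 0 ≤ (M * F0 + F0 ^ 2) / 2 by positivity)]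
    gcongr
  refine (hle y).trans ?_
  by_contra hlt
  push Not at hlt
  nlinarith [mul_pos (sub_pos.mpr hlt) (show 0 < 2 * M + F0 by linarith)]

theorem gauss_complete_sq {n : ℕ} {t a : ℝ} (h : t + a ≠ 0) (x y : EuclideanSpace ℝ (Fin n)) :
    t * ‖x + y‖ ^ 2 + a * ‖y‖ ^ 2 =
      (t + a) * ‖y + (t / (t + a)) • x‖ ^ 2 + t * a / (t + a) * ‖x‖ ^ 2 := by
  rw [norm_add_sq_real, norm_add_sq_real, norm_smul, inner_smul_right, mul_pow,
    Real.norm_eq_abs, sq_abs, real_inner_comm]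
  field_simp
  ring

theorem gauss_integrable (n : ℕ) {b : ℝ} (hb : 0 < b) :
    MeasureTheory.Integrable (fun v : EuclideanSpace ℝ (Fin n) => Real.exp (-b * ‖v‖ ^ 2)) := by
  have h := GaussianFourier.integrable_cexp_neg_mul_sq_norm_add (V := EuclideanSpace ℝ (Fin n))
    (show 0 < (b : ℂ).re from hb) 0 0
  have h2 := h.norm
  refine h2.congr (Filter.Eventually.of_forall fun v => ?_)
  simp only [Complex.norm_exp]
  congr 1
  simp [← Complex.ofReal_pow]

theorem latGauss_scale {n : ℕ} (L : Submodule ℤ (EuclideanSpace ℝ (Fin n))) [DiscreteTopology L]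
    (hspan : Submodule.span ℝ (L : Set (EuclideanSpace ℝ (Fin n))) = ⊤) {t a : ℝ} (ht : 0 < t)
    (ha : 0 < a) :
    latGauss L (t * a / (t + a)) 0 ≤ ((t + a) / a) ^ (n / 2 : ℝ) * latGauss L t 0 := by
  have hta : 0 < t + a := by positivity
  refine Real.tsum_le_of_sum_le (fun _ => (Real.exp_pos _).le) fun s => ?_
  have hterm : ∀ x y : EuclideanSpace ℝ (Fin n),
      Real.exp (-(t * ‖x + y‖ ^ 2)) * Real.exp (-a * ‖y‖ ^ 2) =
      Real.exp (-(t * a / (t + a) * ‖x + 0‖ ^ 2)) *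
        Real.exp (-(t + a) * ‖y + (t / (t + a)) • x‖ ^ 2) := by
    intro x y
    rw [← Real.exp_add, ← Real.exp_add, add_zero]
    congr 1
    linear_combination -gauss_complete_sq hta.ne' x y
  have hint : ∀ x : EuclideanSpace ℝ (Fin n), MeasureTheory.Integrable (fun y =>
      Real.exp (-(t * ‖x + y‖ ^ 2)) * Real.exp (-a * ‖y‖ ^ 2)) := by
    intro x
    simp only [hterm]
    exact ((gauss_integrable n hta).comp_add_right _).const_mul _
  have hval : ∀ x : EuclideanSpace ℝ (Fin n), ∫ y,
      Real.exp (-(t * ‖x + y‖ ^ 2)) * Real.exp (-a * ‖y‖ ^ 2) =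
      Real.exp (-(t * a / (t + a) * ‖x + 0‖ ^ 2)) * (π / (t + a)) ^ (n / 2 : ℝ) := by
    intro x
    simp only [hterm]
    rw [MeasureTheory.integral_const_mul, MeasureTheory.integral_add_right_eq_self
      (fun y : EuclideanSpace ℝ (Fin n) => Real.exp (-(t + a) * ‖y‖ ^ 2)),
      GaussianFourier.integral_rexp_neg_mul_sq_norm hta]
    simp
  have hmono : ∫ y : EuclideanSpace ℝ (Fin n), ∑ x ∈ s,
      Real.exp (-(t * ‖(x : EuclideanSpace ℝ (Fin n)) + y‖ ^ 2)) * Real.exp (-a * ‖y‖ ^ 2) ≤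
      ∫ y : EuclideanSpace ℝ (Fin n), latGauss L t 0 * Real.exp (-a * ‖y‖ ^ 2) := by
    refine MeasureTheory.integral_mono (MeasureTheory.integrable_finsetSum _ fun x _ => hint x)
      ((gauss_integrable n ha).const_mul _) fun y => ?_
    simp only
    rw [← Finset.sum_mul]
    gcongr
    refine le_trans ?_ (latGauss_le_zero L hspan ht y)
    exact (gauss_summable L ht y).sum_le_tsum s fun _ _ => (Real.exp_pos _).le
  rw [MeasureTheory.integral_finsetSum s fun (x : L) _ => hint (x : EuclideanSpace ℝ (Fin n)), MeasureTheory.integral_const_mul,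
    GaussianFourier.integral_rexp_neg_mul_sq_norm ha] at hmono
  simp only [hval, ← Finset.sum_mul, finrank_euclideanSpace, Fintype.card_fin] at hmono
  have hr : (π / a) ^ (n / 2 : ℝ) = ((t + a) / a) ^ (n / 2 : ℝ) * (π / (t + a)) ^ (n / 2 : ℝ) := by
    rw [← Real.mul_rpow (by positivity) (by positivity)]
    congr 1
    field_simp
  rw [hr] at hmono
  have hpos : 0 < (π / (t + a)) ^ (n / 2 : ℝ) := by positivity
  refine le_of_mul_le_mul_right ?_ hpos
  linarith

theorem latticeMinDist_pos {n : ℕ} (L : Submodule ℤ (EuclideanSpace ℝ (Fin n)))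
    [DiscreteTopology L] (x : EuclideanSpace ℝ (Fin n)) (hx : x ∈ L) (hx0 : x ≠ 0) :
    0 < latticeMinDist L := by
  obtain ⟨ε, hε, h⟩ := Metric.isOpen_singleton_iff.mp (isOpen_discrete {(0 : L)})
  refine lt_of_lt_of_le hε (le_csInf ⟨_, x, hx, hx0, rfl⟩ ?_)
  rintro _ ⟨y, hy, hy0, rfl⟩
  by_contra hlt
  push Not at hlt
  have := h ⟨y, hy⟩ (by rw [dist_zero_right]; exact hlt)
  exact hy0 (congrArg Subtype.val this)

theorem latticeMinDist_le {n : ℕ} (L : Submodule ℤ (EuclideanSpace ℝ (Fin n)))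
    (x : EuclideanSpace ℝ (Fin n)) (hx : x ∈ L) (hx0 : x ≠ 0) :
    latticeMinDist L ≤ ‖x‖ := by
  refine csInf_le ⟨0, ?_⟩ ⟨x, hx, hx0, rfl⟩
  rintro _ ⟨y, -, -, rfl⟩
  exact norm_nonneg y

/-- Corollary of Banaszczyk's lemma: tail bound for the Gaussian sum over a lattice. -/
theorem banaszczyk_corollary {n : ℕ} (hn : 0 < n)
    (L : Submodule ℤ (EuclideanSpace ℝ (Fin n))) [DiscreteTopology L]
    (hspan : Submodule.span ℝ (L : Set (EuclideanSpace ℝ (Fin n))) = ⊤)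
    (c C τ : ℝ)
    (hc : 1 / Real.sqrt (2 * π) < c)
    (hC : C = c * Real.sqrt (2 * π * Real.exp 1) * Real.exp (-π * c ^ 2))
    (hτ : τ > Real.sqrt n * c / latticeMinDist L) :
    ∑' x : {x : EuclideanSpace ℝ (Fin n) // x ∈ L ∧ x ≠ 0},
        Real.exp (-τ ^ 2 * π * ‖(x : EuclideanSpace ℝ (Fin n))‖ ^ 2)
      ≤ C ^ n / (1 - C ^ n) := by
  have hc0 : 0 < c := lt_trans (by positivity) hc
  have hpi := Real.pi_pos
  set u := 2 * π * c ^ 2 with hu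
  have hu1 : 1 < u := by
    rw [div_lt_iff₀ (by positivity)] at hc
    have h1 : (1 : ℝ) < (c * Real.sqrt (2 * π)) ^ 2 := by nlinarith
    rw [mul_pow, Real.sq_sqrt (by positivity)] at h1
    linarith
  have hCpos : 0 < C := by rw [hC]; positivity
  have hC2 : C ^ 2 = u * Real.exp (1 - u) := by
    rw [hC, mul_pow, mul_pow, Real.sq_sqrt (by positivity), ← Real.exp_nat_mul, sub_eq_add_neg,
      Real.exp_add, hu]
    rw [show ((2 : ℕ) : ℝ) * (-π * c ^ 2) = -(2 * π * c ^ 2) by push_cast; ring]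
    ring
  have hClt : C < 1 := by
    have h1 : u < Real.exp (u - 1) := by
      have := Real.add_one_lt_exp (show u - 1 ≠ 0 by linarith)
      linarith
    have h2 : C ^ 2 < 1 := by
      rw [hC2, show 1 - u = -(u - 1) by ring, Real.exp_neg, ← div_eq_mul_inv,
        div_lt_one (Real.exp_pos _)]
      exact h1
    nlinarith
  have hCn : C ^ n < 1 := pow_lt_one₀ hCpos.le hClt hn.ne'
  have hCn0 : 0 < C ^ n := by positivity
  have hCn' : C ^ n = u ^ (n / 2 : ℝ) * Real.exp ((1 - u) * n / 2) := by
    have h1 : C ^ n = (C ^ 2) ^ (n / 2 : ℝ) := by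
      rw [← Real.rpow_natCast, ← Real.rpow_natCast, ← Real.rpow_mul hCpos.le]
      congr 1
      push_cast
      ring
    rw [h1, hC2, Real.mul_rpow (by linarith) (Real.exp_pos _).le, ← Real.exp_mul]
    congr 2
    ring
  rcases isEmpty_or_nonempty {x : EuclideanSpace ℝ (Fin n) // x ∈ L ∧ x ≠ 0} with hE | ⟨⟨x0, hx0⟩⟩
  · rw [tsum_empty]
    exact div_nonneg hCn0.le (by linarith)
  have hmin := latticeMinDist_pos L x0 hx0.1 hx0.2
  have hτ0 : 0 < τ := lt_of_le_of_lt (by positivity) hτ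
  have hlow : ∀ x ∈ L, x ≠ 0 → n * c ^ 2 ≤ τ ^ 2 * ‖x‖ ^ 2 := by
    intro x hx hxne
    have h1 : Real.sqrt n * c < τ * latticeMinDist L := (div_lt_iff₀ hmin).mp hτ
    have h2 : Real.sqrt n * c ≤ τ * ‖x‖ :=
      h1.le.trans (mul_le_mul_of_nonneg_left (latticeMinDist_le L x hx hxne) hτ0.le)
    have h3 := pow_le_pow_left₀ (by positivity) h2 2
    rwa [mul_pow, mul_pow, Real.sq_sqrt (by positivity)] at h3
  set t := τ ^ 2 * π with ht
  have ht0 : 0 < t := by positivity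
  set S := ∑' x : {x : EuclideanSpace ℝ (Fin n) // x ∈ L ∧ x ≠ 0},
        Real.exp (-τ ^ 2 * π * ‖(x : EuclideanSpace ℝ (Fin n))‖ ^ 2) with hS
  -- splitting off the zero vector
  have split : ∀ b : ℝ, 0 < b →
      Summable (fun x : {x : EuclideanSpace ℝ (Fin n) // x ∈ L ∧ x ≠ 0} =>
        Real.exp (-(b * ‖(x : EuclideanSpace ℝ (Fin n))‖ ^ 2))) ∧
      latGauss L b 0 = 1 + ∑' x : {x : EuclideanSpace ℝ (Fin n) // x ∈ L ∧ x ≠ 0},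
        Real.exp (-(b * ‖(x : EuclideanSpace ℝ (Fin n))‖ ^ 2)) := by
    intro b hb
    have hs := gauss_summable_zero L hb
    let e : {x : EuclideanSpace ℝ (Fin n) // x ∈ L ∧ x ≠ 0} ≃ ({0}ᶜ : Set L) :=
      { toFun := fun x => ⟨⟨x.1, x.2.1⟩, fun h => x.2.2 (congrArg Subtype.val h)⟩
        invFun := fun x => ⟨x.1.1, x.1.2, fun h => x.2 (Subtype.ext h)⟩
        left_inv := fun _ => rfl
        right_inv := fun _ => rfl }
    constructor
    · exact e.summable_iff.mpr (hs.subtype ({0}ᶜ : Set L))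
    · have h1 := hs.tsum_subtype_add_tsum_subtype_compl {0}
      have h2 := e.tsum_eq (fun x : ({0}ᶜ : Set L) =>
        Real.exp (-(b * ‖((x : L) : EuclideanSpace ℝ (Fin n))‖ ^ 2)))
      unfold latGauss
      simp only [add_zero]
      rw [← h1, ← h2]
      congr 1
      rw [tsum_singleton (0 : L) (fun x : L =>
        Real.exp (-(b * ‖(x : EuclideanSpace ℝ (Fin n))‖ ^ 2)))]
      simp
  have hSt : S = ∑' x : {x : EuclideanSpace ℝ (Fin n) // x ∈ L ∧ x ≠ 0},
        Real.exp (-(t * ‖(x : EuclideanSpace ℝ (Fin n))‖ ^ 2)) := by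
    rw [hS]
    congr 1
    ext x
    congr 1
    rw [ht]
    ring
  obtain ⟨hst, hgt⟩ := split t ht0
  rw [← hSt] at hgt
  set a := t / (u - 1) with ha
  have ha0 : 0 < a := div_pos ht0 (by linarith)
  have hu10 : u - 1 ≠ 0 := by linarith
  have hu0 : u ≠ 0 := by linarith
  have hta : t + a = t * u / (u - 1) := by rw [ha]; field_simp; ring
  have e1 : t * a / (t + a) = t / u := by rw [hta, ha]; field_simp
  have e2 : (t + a) / a = u := by rw [hta, ha]; field_simp
  have hscale := latGauss_scale L hspan ht0 ha0
  rw [e1, e2] at hscale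
  have htu : 0 < t / u := div_pos ht0 (by linarith)
  obtain ⟨hsu, hgu⟩ := split (t / u) htu
  have hbound : S ≤ Real.exp ((1 - u) * n / 2) * latGauss L (t / u) 0 := by
    have h1 : S ≤ ∑' x : {x : EuclideanSpace ℝ (Fin n) // x ∈ L ∧ x ≠ 0},
        Real.exp ((1 - u) * n / 2) *
          Real.exp (-(t / u * ‖(x : EuclideanSpace ℝ (Fin n))‖ ^ 2)) := by
      rw [hSt]
      refine Summable.tsum_le_tsum (fun x => ?_) hst (hsu.mul_left _)
      rw [← Real.exp_add]
      apply Real.exp_le_exp.mpr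
      have h2 := hlow x.1 x.2.1 x.2.2
      have h3 : n * u / 2 ≤ t * ‖x.1‖ ^ 2 := by
        rw [hu, ht]
        nlinarith
      have h4 : (1 - 1 / u) * (n * u / 2) ≤ (1 - 1 / u) * (t * ‖x.1‖ ^ 2) := by
        apply mul_le_mul_of_nonneg_left h3
        rw [sub_nonneg, div_le_one (by linarith)]
        exact hu1.le
      have h5 : (1 - 1 / u) * (n * u / 2) = (u - 1) * n / 2 := by field_simp
      have h6 : (1 - 1 / u) * (t * ‖x.1‖ ^ 2) = t * ‖x.1‖ ^ 2 - t / u * ‖x.1‖ ^ 2 := by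
        ring
      linarith
    rw [tsum_mul_left] at h1
    refine h1.trans ?_
    gcongr
    linarith
  have hfin : S ≤ C ^ n * (1 + S) := by
    rw [hCn', ← hgt]
    refine hbound.trans ?_
    have := mul_le_mul_of_nonneg_left hscale (Real.exp_pos ((1 - u) * n / 2)).le
    linarith
  rw [le_div_iff₀ (by linarith)]
  linarith
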